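/- (Inconsistency of the joint ML impedance estimator.) Let S₁, S₂, σₙ², σ_H² be positive reals, α = S₂/S₁, c = S₁σ_H²/(S₁σ_H² + σₙ²), and let F ∈ ℂ with F ≠ 0. Define the limiting correlations p₁₁ = σ_H² + σₙ²/S₁, p₁₂ = σ_H²·F, p₂₁ = σ_H²·conj(F), p₂₂ = |F|²·σ_H² + σₙ²/S₂. Then p₁₂ + (α·p₂₂ − c·p₁₁)·F − α·c·p₂₁·F² = F·(σₙ²/S₁)·(1 + α·c·|F|²), which is nonzero. In particular, the true value F is not a root of the limiting quadratic, so neither limiting root of the joint ML quadratic equals F. -/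

import Mathlib

/-- Inconsistency of the joint ML impedance estimator.  At the
limiting correlations `p₁₁, p₁₂, p₂₁, p₂₂`, the joint ML quadratic evaluated at
the true `F ≠ 0` equals `F·(σₙ²/S₁)·(1 + αc|F|²) ≠ 0`; hence the true `F` is
not a root of the limiting quadratic and the joint ML estimator is
inconsistent. -/
theorem joint_ml_inconsistent (S1 S2 σn2 σH2 : ℝ)
    (hS1 : 0 < S1) (hS2 : 0 < S2) (hσn2 : 0 < σn2) (hσH2 : 0 < σH2)
    (α c : ℝ) (hα : α = S2 / S1) (hc : c = S1 * σH2 / (S1 * σH2 + σn2))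
    (F : ℂ) (hF : F ≠ 0)
    (p11 p12 p21 p22 : ℂ)
    (h11 : p11 = ((σH2 + σn2 / S1 : ℝ) : ℂ))
    (h12 : p12 = (σH2 : ℂ) * F)
    (h21 : p21 = (σH2 : ℂ) * (starRingEnd ℂ) F)
    (h22 : p22 = (Complex.normSq F : ℂ) * (σH2 : ℂ) + ((σn2 / S2 : ℝ) : ℂ)) :
    p12 + ((α : ℂ) * p22 - (c : ℂ) * p11) * F - (α : ℂ) * (c : ℂ) * p21 * F ^ 2
        = F * ((σn2 / S1 : ℝ) : ℂ) * (1 + (α : ℂ) * (c : ℂ) * (Complex.normSq F : ℂ))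
      ∧ p12 + ((α : ℂ) * p22 - (c : ℂ) * p11) * F - (α : ℂ) * (c : ℂ) * p21 * F ^ 2 ≠ 0 := by
  have hD : S1 * σH2 + σn2 ≠ 0 := by positivity
  have hcp : (c : ℂ) * ((σH2 + σn2 / S1 : ℝ) : ℂ) = σH2 := by
    rw [← Complex.ofReal_mul, hc]
    congr 1
    field_simp
  have hαn : (α : ℂ) * ((σn2 / S2 : ℝ) : ℂ) = ((σn2 / S1 : ℝ) : ℂ) := by
    rw [← Complex.ofReal_mul, hα]
    congr 1
    field_simp
  have hcp' : (c : ℂ) * ((σH2 : ℂ) + ((σn2 / S1 : ℝ) : ℂ)) = σH2 := by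
    rw [← Complex.ofReal_add, hcp]
  have hN : (starRingEnd ℂ) F * F = (Complex.normSq F : ℂ) :=
    (Complex.normSq_eq_conj_mul_self).symm
  have key : p12 + ((α : ℂ) * p22 - (c : ℂ) * p11) * F - (α : ℂ) * (c : ℂ) * p21 * F ^ 2
      = F * ((σn2 / S1 : ℝ) : ℂ) * (1 + (α : ℂ) * (c : ℂ) * (Complex.normSq F : ℂ)) := by
    rw [h11, h12, h21, h22]
    linear_combination (-F) * hcp + F * hαn - (α : ℂ) * c * σH2 * F * hN
      - (α : ℂ) * (Complex.normSq F : ℂ) * F * hcp'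
  refine ⟨key, ?_⟩
  rw [key]
  have hα0 : 0 < α := hα ▸ div_pos hS2 hS1
  have hc0 : 0 < c := by rw [hc]; positivity
  have hfac : 0 < 1 + α * c * Complex.normSq F :=
    add_pos_of_pos_of_nonneg one_pos
      (mul_nonneg (mul_pos hα0 hc0).le (Complex.normSq_nonneg F))
  refine mul_ne_zero (mul_ne_zero hF ?_) ?_
  · exact Complex.ofReal_ne_zero.mpr (div_pos hσn2 hS1).ne'
  · exact_mod_cast hfac.ne'
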